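/- Let n ≥ 2 and let G ⊆ ℝⁿ be a bounded subregion. Define the isoperimetric profile ℓ : [0, Lⁿ(G)) → ℝ by ℓ(A) := inf{ Per(E) : E ⊆ cl(G) Lebesgue measurable with Lⁿ(E) = A }. Then ℓ is continuous on [0, Lⁿ(G)). -/

import Mathlib

open MeasureTheory
open scoped ENNReal

/-- The divergence of a vector field on `ℝⁿ`. -/
noncomputable def vecDiv {n : ℕ} (φ : EuclideanSpace ℝ (Fin n) → EuclideanSpace ℝ (Fin n))
    (x : EuclideanSpace ℝ (Fin n)) : ℝ :=
  ∑ i : Fin n, fderiv ℝ φ x (EuclideanSpace.single i 1) i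

/-- The perimeter of a set `E` relative to an open set `F`:
`Per(E;F) = sup { ∫_E div φ dx : φ ∈ C¹_0(F, ℝⁿ), |φ| ≤ 1 }`. -/
noncomputable def perIn {n : ℕ} (E F : Set (EuclideanSpace ℝ (Fin n))) : ℝ≥0∞ :=
  ⨆ φ : {φ : EuclideanSpace ℝ (Fin n) → EuclideanSpace ℝ (Fin n) //
      ContDiff ℝ 1 φ ∧ HasCompactSupport φ ∧ tsupport φ ⊆ F ∧ ∀ x, ‖φ x‖ ≤ 1},
    ENNReal.ofReal (∫ x in E, vecDiv φ.1 x)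

/-- The perimeter of `E` (relative to all of `ℝⁿ`). -/
noncomputable def per {n : ℕ} (E : Set (EuclideanSpace ℝ (Fin n))) : ℝ≥0∞ :=
  perIn E Set.univ

/-- The isoperimetric profile of `G`:
`ℓ(A) = inf { Per(E) : E ⊆ cl(G) measurable, Lⁿ(E) = A }`. -/
noncomputable def isoProfile {n : ℕ} (G : Set (EuclideanSpace ℝ (Fin n))) (A : ℝ≥0∞) : ℝ≥0∞ :=
  sInf {P : ℝ≥0∞ | ∃ E : Set (EuclideanSpace ℝ (Fin n)),
    MeasurableSet E ∧ E ⊆ closure G ∧ volume E = A ∧ per E = P}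

open Filter Topology Metric

theorem exists_abs_deriv_smoothTransition_le :
    ∃ M : ℝ, 0 ≤ M ∧ ∀ t, |deriv Real.smoothTransition t| ≤ M := by
  have hc : Continuous (deriv Real.smoothTransition) :=
    (Real.smoothTransition.contDiff (n := 1)).continuous_deriv le_rfl
  have hs : HasCompactSupport (deriv Real.smoothTransition) := by
    refine HasCompactSupport.intro (isCompact_Icc (a := (0 : ℝ)) (b := 1)) fun t ht => ?_
    rw [Set.mem_Icc, not_and_or, not_le, not_le] at ht
    rcases ht with ht | ht
    · refine IsLocalMin.deriv_eq_zero (Filter.Eventually.of_forall fun y => ?_)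
      rw [Real.smoothTransition.zero_of_nonpos ht.le]
      exact Real.smoothTransition.nonneg y
    · refine IsLocalMax.deriv_eq_zero (Filter.Eventually.of_forall fun y => ?_)
      rw [Real.smoothTransition.one_of_one_le ht.le]
      exact Real.smoothTransition.le_one y
  obtain ⟨M, hM⟩ := hc.bounded_above_of_compact_support hs
  exact ⟨M, (norm_nonneg _).trans (hM 0), hM⟩

theorem volume_real_ball {n : ℕ} (x : EuclideanSpace ℝ (Fin n)) {r : ℝ} (hr : 0 < r) :
    volume.real (ball x r) = r ^ n * volume.real (ball (0 : EuclideanSpace ℝ (Fin n)) 1) := by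
  rw [measureReal_def, Measure.addHaar_ball_of_pos volume x hr, ENNReal.toReal_mul,
    ENNReal.toReal_ofReal (by positivity), finrank_euclideanSpace_fin, measureReal_def]

theorem exists_cutoff (n : ℕ) :
    ∃ C : ℝ, 0 ≤ C ∧ ∀ (x : EuclideanSpace ℝ (Fin n)) (t s : ℝ), 0 < t → t < s →
      ∃ η : EuclideanSpace ℝ (Fin n) → ℝ, ContDiff ℝ 1 η ∧ HasCompactSupport η ∧
        (∀ y, 0 ≤ η y) ∧ (∀ y, η y ≤ 1) ∧ (∀ y, dist y x ≤ t → η y = 1) ∧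
        (∀ y, s ≤ dist y x → η y = 0) ∧ ∫ y, ‖fderiv ℝ η y‖ ≤ C * s ^ (n - 1) := by
  obtain ⟨M, hM0, hM⟩ := exists_abs_deriv_smoothTransition_le
  set ω := volume.real (ball (0 : EuclideanSpace ℝ (Fin n)) 1) with hω
  have hω0 : 0 ≤ ω := measureReal_nonneg
  refine ⟨2 * M * n * ω, by positivity, fun x t s ht hts => ?_⟩
  have hs : 0 < s := ht.trans hts
  have hd : 0 < s ^ 2 - t ^ 2 := by nlinarith
  set q : EuclideanSpace ℝ (Fin n) → ℝ := fun y => (s ^ 2 - ‖y - x‖ ^ 2) / (s ^ 2 - t ^ 2) with hq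
  have hqc : ContDiff ℝ 1 q :=
    (contDiff_const.sub ((contDiff_id.sub contDiff_const).norm_sq ℝ)).div_const _
  set η : EuclideanSpace ℝ (Fin n) → ℝ := fun y => Real.smoothTransition (q y) with hη
  have hηc : ContDiff ℝ 1 η := (Real.smoothTransition.contDiff (n := 1)).comp hqc
  have h0 : ∀ y, 0 ≤ η y := fun y => Real.smoothTransition.nonneg _
  have h1 : ∀ y, η y ≤ 1 := fun y => Real.smoothTransition.le_one _
  have hin : ∀ y, dist y x ≤ t → η y = 1 := fun y hy => by
    refine Real.smoothTransition.one_of_one_le ?_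
    rw [dist_eq_norm] at hy
    rw [hq, one_le_div hd]
    gcongr
  have hout : ∀ y, s ≤ dist y x → η y = 0 := fun y hy => by
    refine Real.smoothTransition.zero_of_nonpos ?_
    rw [dist_eq_norm] at hy
    refine div_nonpos_of_nonpos_of_nonneg ?_ hd.le
    rw [sub_nonpos]
    gcongr
  refine ⟨η, hηc, ?_, h0, h1, hin, hout, ?_⟩
  · refine HasCompactSupport.intro (isCompact_closedBall x s) fun y hy => hout y ?_
    rw [mem_closedBall, not_le] at hy
    exact hy.le
  have hfd : ∀ y, HasFDerivAt η (deriv Real.smoothTransition (q y) •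
      ((s ^ 2 - t ^ 2)⁻¹ • (-2 : ℝ) • innerSL ℝ (y - x))) y := fun y => by
    have e1 : HasFDerivAt (fun y => y - x) (ContinuousLinearMap.id ℝ _) y :=
      (hasFDerivAt_id y).sub_const x
    have e2 : HasFDerivAt q ((s ^ 2 - t ^ 2)⁻¹ • (-2 : ℝ) • innerSL ℝ (y - x)) y := by
      have := (e1.norm_sq.const_sub (s ^ 2)).const_smul ((s ^ 2 - t ^ 2)⁻¹)
      refine this.congr_of_eventuallyEq (Filter.Eventually.of_forall fun z => ?_) |>.congr_fderiv ?_
      · simp [hq, div_eq_inv_mul]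
      · ext v; simp
    exact (((Real.smoothTransition.contDiff (n := 1)).differentiable one_ne_zero
      (q y)).hasDerivAt).comp_hasFDerivAt y e2
  have hbd : ∀ y, ‖fderiv ℝ η y‖ ≤
      (ball x s \ ball x t).indicator (fun _ => 2 * M / (s - t)) y := fun y => by
    by_cases hy : y ∈ ball x s \ ball x t
    · rw [Set.indicator_of_mem hy, (hfd y).fderiv, norm_smul, norm_smul]
      have hys : ‖y - x‖ < s := by simpa [dist_eq_norm] using hy.1
      have e3 : ‖(-2 : ℝ) • innerSL ℝ (y - x)‖ ≤ 2 * s := by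
        rw [norm_smul, innerSL_apply_norm, norm_neg, Real.norm_ofNat]
        linarith
      rw [Real.norm_eq_abs, norm_inv, Real.norm_of_nonneg hd.le]
      calc _ ≤ M * ((s ^ 2 - t ^ 2)⁻¹ * (2 * s)) := by
            gcongr
            exact hM _
        _ = 2 * M / (s - t) * (s / (s + t)) := by
            have : s - t ≠ 0 := by linarith
            have : s + t ≠ 0 := by positivity
            rw [show s ^ 2 - t ^ 2 = (s - t) * (s + t) by ring]
            field_simp
        _ ≤ 2 * M / (s - t) * 1 := by
            have : 0 < s - t := by linarith
            gcongr
            rw [div_le_one (by positivity)]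
            linarith
        _ = _ := mul_one _
    · rw [Set.indicator_of_notMem hy]
      refine (norm_eq_zero.2 ?_).le
      rw [Set.mem_sdiff, not_and_or, not_not, mem_ball, mem_ball, not_lt] at hy
      rcases hy with hy | hy
      · refine IsLocalMin.fderiv_eq_zero (Filter.Eventually.of_forall fun z => ?_)
        rw [hout y hy]
        exact h0 z
      · refine IsLocalMax.fderiv_eq_zero (Filter.Eventually.of_forall fun z => ?_)
        rw [hin y hy.le]
        exact h1 z
  have hmeas : MeasurableSet (ball x s \ ball x t) := measurableSet_ball.diff measurableSet_ball
  have hfin : volume (ball x s \ ball x t) ≠ ⊤ :=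
    ((measure_mono Set.sdiff_subset).trans_lt measure_ball_lt_top).ne
  have hst : 0 < s - t := by linarith
  calc ∫ y, ‖fderiv ℝ η y‖
      ≤ ∫ y, (ball x s \ ball x t).indicator (fun _ => 2 * M / (s - t)) y :=
        integral_mono_of_nonneg (Filter.Eventually.of_forall fun y => norm_nonneg _)
          ((integrable_indicator_iff hmeas).2 (integrableOn_const hfin))
          (Filter.Eventually.of_forall hbd)
    _ = (s ^ n - t ^ n) * ω * (2 * M / (s - t)) := by
        rw [integral_indicator hmeas, setIntegral_const, smul_eq_mul,
          measureReal_sdiff (ball_subset_ball hts.le) measurableSet_ball,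
          volume_real_ball x hs, volume_real_ball x ht, ← sub_mul]
    _ ≤ ((s - t) * n * s ^ (n - 1)) * ω * (2 * M / (s - t)) := by
        have := (le_abs_self _).trans (abs_pow_sub_pow_le s t n)
        rw [abs_of_pos hst, abs_of_pos hs, abs_of_pos ht, max_eq_left hts.le] at this
        gcongr
    _ = 2 * M * n * ω * s ^ (n - 1) := by
        field_simp

section VectorField

variable {n : ℕ} {φ : EuclideanSpace ℝ (Fin n) → EuclideanSpace ℝ (Fin n)}
  {η : EuclideanSpace ℝ (Fin n) → ℝ}

theorem continuous_vecDiv (hφ : ContDiff ℝ 1 φ) : Continuous (vecDiv φ) := by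
  have h := hφ.continuous_fderiv one_ne_zero
  unfold vecDiv
  fun_prop

theorem hasCompactSupport_vecDiv (hφs : HasCompactSupport φ) : HasCompactSupport (vecDiv φ) := by
  refine (hφs.fderiv ℝ).mono fun x hx => ?_
  contrapose! hx
  simp only [Function.mem_support, not_not] at hx ⊢
  simp [vecDiv, hx]

theorem integrable_vecDiv (hφ : ContDiff ℝ 1 φ) (hφs : HasCompactSupport φ) :
    Integrable (vecDiv φ) :=
  (continuous_vecDiv hφ).integrable_of_hasCompactSupport (hasCompactSupport_vecDiv hφs)

theorem continuous_fderiv_apply (hη : ContDiff ℝ 1 η) (hφ : ContDiff ℝ 1 φ) :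
    Continuous fun x => fderiv ℝ η x (φ x) := by
  have h := hη.continuous_fderiv one_ne_zero
  have h' := hφ.continuous
  fun_prop

theorem integrable_fderiv_apply (hη : ContDiff ℝ 1 η) (hφ : ContDiff ℝ 1 φ)
    (hφs : HasCompactSupport φ) : Integrable fun x => fderiv ℝ η x (φ x) := by
  refine (continuous_fderiv_apply hη hφ).integrable_of_hasCompactSupport (hφs.mono fun x hx => ?_)
  contrapose! hx
  simp only [Function.mem_support, not_not] at hx ⊢
  simp [hx]

theorem fderiv_apply_eq_sum (x : EuclideanSpace ℝ (Fin n)) (v : EuclideanSpace ℝ (Fin n)) :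
    fderiv ℝ η x v = ∑ i, v i * fderiv ℝ η x (EuclideanSpace.single i 1) := by
  have hv : v = ∑ i, v i • EuclideanSpace.single i (1 : ℝ) := by
    ext j
    simp [Pi.single_apply]
  conv_lhs => rw [hv]
  simp [map_sum]

theorem vecDiv_one_sub_smul (hη : ContDiff ℝ 1 η) (hφ : ContDiff ℝ 1 φ)
    (x : EuclideanSpace ℝ (Fin n)) :
    vecDiv (fun y => (1 - η y) • φ y) x = (1 - η x) * vecDiv φ x - fderiv ℝ η x (φ x) := by
  have h1 : HasFDerivAt (fun y => 1 - η y) (-fderiv ℝ η x) x :=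
    ((hη.differentiable one_ne_zero x).hasFDerivAt).const_sub 1
  have h2 := (hφ.differentiable one_ne_zero x).hasFDerivAt
  have h3 : HasFDerivAt (fun y => (1 - η y) • φ y) _ x := h1.smul h2
  rw [vecDiv, h3.fderiv, fderiv_apply_eq_sum, vecDiv, Finset.mul_sum,
    ← Finset.sum_sub_distrib]
  refine Finset.sum_congr rfl fun i _ => ?_
  simp
  ring

theorem integral_mul_vecDiv (hη : ContDiff ℝ 1 η) (hφ : ContDiff ℝ 1 φ)
    (hφs : HasCompactSupport φ) :
    ∫ x, η x * vecDiv φ x = -∫ x, fderiv ℝ η x (φ x) := by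
  have hDφ := hφ.continuous_fderiv one_ne_zero
  have hDη := hη.continuous_fderiv one_ne_zero
  have hφi : ∀ i, ContDiff ℝ 1 fun x => φ x i := fun i => contDiff_euclidean.1 hφ i
  have hDφi := fun i => (hφi i).continuous_fderiv one_ne_zero
  have hφis : ∀ i, HasCompactSupport fun x => φ x i := fun i =>
    hφs.comp_left (g := fun v : EuclideanSpace ℝ (Fin n) => v i) rfl
  have hcoord : ∀ i x v, fderiv ℝ φ x v i = fderiv ℝ (fun y => φ y i) x v := fun i x v => by
    have h := (hφ.differentiable one_ne_zero x).hasFDerivAt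
    have h' := ((EuclideanSpace.proj (𝕜 := ℝ) i).hasFDerivAt.comp x h).fderiv
    have : (fun y => φ y i) = (EuclideanSpace.proj (𝕜 := ℝ) i) ∘ φ := rfl
    rw [this, h']
    rfl
  have i1 : ∀ i, Integrable fun x => η x * fderiv ℝ (fun y => φ y i) x
      (EuclideanSpace.single i 1) := fun i => by
    refine Continuous.integrable_of_hasCompactSupport ?_ ?_
    · have := hDφi i
      have := hη.continuous
      fun_prop
    · exact ((hφis i).fderiv_apply ℝ _).mul_left
  have i2 : ∀ i, Integrable fun x => fderiv ℝ η x (EuclideanSpace.single i 1) * φ x i :=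
    fun i => by
      refine Continuous.integrable_of_hasCompactSupport ?_ (hφis i).mul_left
      have := hφ.continuous
      fun_prop
  have i3 : ∀ i, Integrable fun x => η x * φ x i := fun i => by
    refine Continuous.integrable_of_hasCompactSupport ?_ (hφis i).mul_left
    have := hη.continuous
    have := hφ.continuous
    fun_prop
  have hsum := fun x => fderiv_apply_eq_sum (η := η) x (φ x)
  simp only [hsum, vecDiv, hcoord, Finset.mul_sum]
  rw [integral_finsetSum _ fun i _ => i1 i, integral_finsetSum _ fun i _ => by
    simpa only [mul_comm] using i2 i, ← Finset.sum_neg_distrib]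
  refine Finset.sum_congr rfl fun i _ => ?_
  rw [integral_mul_fderiv_eq_neg_fderiv_mul_of_integrable (i2 i) (i1 i) (i3 i)
    (fun x _ => hη.differentiable one_ne_zero x)
    (fun x _ => (hφi i).differentiable one_ne_zero x)]
  simp only [mul_comm]

theorem setIntegral_vecDiv_le_per {E : Set (EuclideanSpace ℝ (Fin n))} (hE : per E ≠ ⊤)
    (hφ : ContDiff ℝ 1 φ) (hφs : HasCompactSupport φ) (hφ1 : ∀ x, ‖φ x‖ ≤ 1) :
    ∫ x in E, vecDiv φ x ≤ (per E).toReal := by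
  refine (ENNReal.ofReal_le_iff_le_toReal hE).1 ?_
  exact le_iSup_of_le (⟨φ, hφ, hφs, Set.subset_univ _, hφ1⟩ : {φ // _}) le_rfl

theorem per_le_of_forall {E : Set (EuclideanSpace ℝ (Fin n))} {P : ℝ}
    (h : ∀ φ : EuclideanSpace ℝ (Fin n) → EuclideanSpace ℝ (Fin n), ContDiff ℝ 1 φ →
      HasCompactSupport φ → (∀ x, ‖φ x‖ ≤ 1) → ∫ x in E, vecDiv φ x ≤ P) :
    per E ≤ ENNReal.ofReal P :=
  iSup_le fun φ => ENNReal.ofReal_le_ofReal (h φ.1 φ.2.1 φ.2.2.1 φ.2.2.2.2)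

theorem setIntegral_one_sub_mul_vecDiv_le {E : Set (EuclideanSpace ℝ (Fin n))} (hE : per E ≠ ⊤)
    (hη : ContDiff ℝ 1 η) (h0 : ∀ x, 0 ≤ η x) (h1 : ∀ x, η x ≤ 1)
    (hφ : ContDiff ℝ 1 φ) (hφs : HasCompactSupport φ) (hφ1 : ∀ x, ‖φ x‖ ≤ 1) :
    ∫ x in E, (1 - η x) * vecDiv φ x ≤ (per E).toReal + ∫ x in E, fderiv ℝ η x (φ x) := by
  have hψ : ContDiff ℝ 1 fun y => (1 - η y) • φ y := (contDiff_const.sub hη).smul hφ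
  have hψs : HasCompactSupport fun y => (1 - η y) • φ y := hφs.smul_left (f := fun y => 1 - η y)
  have hψ1 : ∀ x, ‖(1 - η x) • φ x‖ ≤ 1 := fun x => by
    rw [norm_smul, Real.norm_of_nonneg (sub_nonneg.2 (h1 x))]
    exact mul_le_one₀ (by linarith [h0 x]) (norm_nonneg _) (hφ1 x)
  have hle := setIntegral_vecDiv_le_per hE hψ hψs hψ1
  have hi := (integrable_vecDiv hψ hψs).integrableOn (s := E)
  have hi' := (integrable_fderiv_apply hη hφ hφs).integrableOn (s := E)
  have : ∫ x in E, (1 - η x) * vecDiv φ x =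
      (∫ x in E, vecDiv (fun y => (1 - η y) • φ y) x) + ∫ x in E, fderiv ℝ η x (φ x) := by
    rw [← integral_add hi hi']
    refine integral_congr_ae (Filter.Eventually.of_forall fun x => ?_)
    exact (sub_eq_iff_eq_add.1 (vecDiv_one_sub_smul hη hφ x).symm)
  linarith

theorem abs_setIntegral_fderiv_apply_le (E : Set (EuclideanSpace ℝ (Fin n)))
    (hη : ContDiff ℝ 1 η) (hηs : HasCompactSupport η) (hφ1 : ∀ x, ‖φ x‖ ≤ 1) :
    |∫ x in E, fderiv ℝ η x (φ x)| ≤ ∫ x, ‖fderiv ℝ η x‖ := by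
  have hi : Integrable fun x => ‖fderiv ℝ η x‖ :=
    ((hη.continuous_fderiv one_ne_zero).integrable_of_hasCompactSupport (hηs.fderiv ℝ)).norm
  calc |∫ x in E, fderiv ℝ η x (φ x)| ≤ ∫ x in E, ‖fderiv ℝ η x‖ :=
        norm_integral_le_of_norm_le hi.integrableOn (Filter.Eventually.of_forall fun x =>
          ((fderiv ℝ η x).le_opNorm _).trans (mul_le_of_le_one_right (norm_nonneg _) (hφ1 x)))
    _ ≤ ∫ x, ‖fderiv ℝ η x‖ :=
        setIntegral_le_integral hi (Filter.Eventually.of_forall fun x => norm_nonneg _)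

end VectorField

/-- Adding or removing a ball changes the perimeter by at most a multiple of `s ^ (n - 1)`. -/
theorem exists_per_ball_le (n : ℕ) :
    ∃ C : ℝ, 0 ≤ C ∧ ∀ (x : EuclideanSpace ℝ (Fin n)) (s : ℝ), 0 < s →
      ∀ E : Set (EuclideanSpace ℝ (Fin n)), MeasurableSet E →
        per (E ∪ ball x s) ≤ per E + ENNReal.ofReal (C * s ^ (n - 1)) ∧
        per (E \ ball x s) ≤ per E + ENNReal.ofReal (C * s ^ (n - 1)) := by
  obtain ⟨C, hC0, hC⟩ := exists_cutoff n
  refine ⟨C, hC0, fun x s hs E hE => ?_⟩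
  by_cases hP : per E = ⊤
  · simp [hP]
  have hCs : 0 ≤ C * s ^ (n - 1) := by positivity
  have hk : ∀ k : ℕ, 0 < s * (1 - 1 / (k + 2 : ℝ)) ∧ s * (1 - 1 / (k + 2 : ℝ)) < s := fun k => by
    have h1 : 1 / (k + 2 : ℝ) < 1 := by
      rw [div_lt_one (by positivity)]
      linarith [(Nat.cast_nonneg k : (0 : ℝ) ≤ k)]
    have h2 : 0 < 1 / (k + 2 : ℝ) := by positivity
    constructor <;> nlinarith
  have hlimt : Tendsto (fun k : ℕ => s * (1 - 1 / (k + 2 : ℝ))) atTop (𝓝 s) := by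
    have h : Tendsto (fun k : ℕ => 1 / (k + 2 : ℝ)) atTop (𝓝 0) := by
      simp only [one_div]
      exact tendsto_inv_atTop_zero.comp
        (tendsto_atTop_add_const_right _ _ tendsto_natCast_atTop_atTop)
    simpa using (h.const_sub 1).const_mul s
  choose η hη hηs h0 h1 hin hout hint using fun k : ℕ => hC x _ s (hk k).1 (hk k).2
  have hlimη : ∀ y, Tendsto (fun k => η k y) atTop (𝓝 ((ball x s).indicator 1 y)) := fun y => by
    by_cases hy : y ∈ ball x s
    · rw [Set.indicator_of_mem hy]
      refine tendsto_const_nhds.congr' ?_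
      filter_upwards [hlimt.eventually (lt_mem_nhds (mem_ball.1 hy))] with k hk
      exact (hin k y hk.le).symm
    · rw [Set.indicator_of_notMem hy]
      refine tendsto_const_nhds.congr fun k => ?_
      exact (hout k y (by simpa using hy)).symm
  have habs : ∀ k y, |η k y| ≤ 1 := fun k y => abs_le.2 ⟨by linarith [h0 k y], h1 k y⟩
  have hlim1 : ∀ φ : EuclideanSpace ℝ (Fin n) → EuclideanSpace ℝ (Fin n), ContDiff ℝ 1 φ →
      HasCompactSupport φ → Tendsto (fun k => ∫ y in E, (1 - η k y) * vecDiv φ y) atTop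
        (𝓝 (∫ y in E \ ball x s, vecDiv φ y)) := fun φ hφ hφs => by
    have e : ∫ y in E \ ball x s, vecDiv φ y =
        ∫ y in E, (1 - (ball x s).indicator 1 y) * vecDiv φ y := by
      rw [Set.sdiff_eq, ← setIntegral_indicator measurableSet_ball.compl]
      congr 1 with y
      by_cases hy : y ∈ ball x s <;> simp [hy]
    rw [e]
    refine tendsto_integral_of_dominated_convergence (fun y => ‖vecDiv φ y‖) (fun k => ?_)
      (integrable_vecDiv hφ hφs).norm.integrableOn (fun k => ?_) ?_
    · exact ((continuous_const.sub (hη k).continuous).mul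
        (continuous_vecDiv hφ)).aestronglyMeasurable
    · refine Filter.Eventually.of_forall fun y => ?_
      rw [norm_mul]
      refine mul_le_of_le_one_left (norm_nonneg _) ?_
      rw [Real.norm_eq_abs, abs_le]
      constructor <;> linarith [h0 k y, h1 k y]
    · exact Filter.Eventually.of_forall fun y => ((hlimη y).const_sub 1).mul_const _
  have hlim2 : ∀ φ : EuclideanSpace ℝ (Fin n) → EuclideanSpace ℝ (Fin n), ContDiff ℝ 1 φ →
      HasCompactSupport φ → Tendsto (fun k => ∫ y, η k y * vecDiv φ y) atTop
        (𝓝 (∫ y in ball x s, vecDiv φ y)) := fun φ hφ hφs => by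
    have e : ∫ y in ball x s, vecDiv φ y = ∫ y, (ball x s).indicator 1 y * vecDiv φ y := by
      rw [← integral_indicator measurableSet_ball]
      congr 1 with y
      by_cases hy : y ∈ ball x s <;> simp [hy]
    rw [e]
    refine tendsto_integral_of_dominated_convergence (fun y => ‖vecDiv φ y‖) (fun k => ?_)
      (integrable_vecDiv hφ hφs).norm (fun k => ?_) ?_
    · exact ((hη k).continuous.mul (continuous_vecDiv hφ)).aestronglyMeasurable
    · refine Filter.Eventually.of_forall fun y => ?_
      rw [norm_mul]
      exact mul_le_of_le_one_left (norm_nonneg _) (habs k y)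
    · exact Filter.Eventually.of_forall fun y => (hlimη y).mul_const _
  rw [← ENNReal.ofReal_toReal hP, ← ENNReal.ofReal_add ENNReal.toReal_nonneg hCs]
  constructor
  · refine per_le_of_forall fun φ hφ hφs hφ1 => ?_
    have hi := integrable_vecDiv hφ hφs
    rw [← Set.sdiff_union_self, setIntegral_union Set.disjoint_sdiff_left measurableSet_ball
      hi.integrableOn hi.integrableOn]
    refine le_of_tendsto' ((hlim1 φ hφ hφs).add (hlim2 φ hφ hφs)) fun k => ?_
    have b1 := setIntegral_one_sub_mul_vecDiv_le hP (hη k) (h0 k) (h1 k) hφ hφs hφ1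
    have b2 := integral_mul_vecDiv (hη k) hφ hφs
    have b3 := integral_add_compl hE (integrable_fderiv_apply (hη k) hφ hφs)
    have b4 := (abs_le.1 (abs_setIntegral_fderiv_apply_le Eᶜ (hη k) (hηs k) hφ1)).1
    linarith [hint k]
  · refine per_le_of_forall fun φ hφ hφs hφ1 => ?_
    refine le_of_tendsto' (hlim1 φ hφ hφs) fun k => ?_
    have b1 := setIntegral_one_sub_mul_vecDiv_le hP (hη k) (h0 k) (h1 k) hφ hφs hφ1
    have b4 := (abs_le.1 (abs_setIntegral_fderiv_apply_le E (hη k) (hηs k) hφ1)).2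
    linarith [hint k]

/-- The balls with a fixed centre cut a given set in all volumes up to that of the largest one. -/
theorem exists_volume_ball_inter_eq {n : ℕ} (hn : n ≠ 0) (S : Set (EuclideanSpace ℝ (Fin n)))
    (x : EuclideanSpace ℝ (Fin n)) {r : ℝ} (hr : 0 < r) {d : ℝ≥0∞}
    (hd : d ≤ volume (ball x r ∩ S)) : ∃ s ∈ Set.Icc 0 r, volume (ball x s ∩ S) = d := by
  have hfin : ∀ s, volume (ball x s ∩ S) ≠ ⊤ := fun s =>
    ((measure_mono Set.inter_subset_left).trans_lt measure_ball_lt_top).ne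
  set ω := volume.real (ball (0 : EuclideanSpace ℝ (Fin n)) 1)
  have hvol : ∀ s, 0 ≤ s → volume.real (ball x s) = s ^ n * ω := fun s hs => by
    rcases hs.eq_or_lt with rfl | hs
    · simp [hn]
    · exact volume_real_ball x hs
  have hmono : ∀ s t, 0 ≤ s → s ≤ t → volume.real (ball x s ∩ S) ≤ volume.real (ball x t ∩ S) ∧
      volume.real (ball x t ∩ S) - volume.real (ball x s ∩ S) ≤ t ^ n * ω - s ^ n * ω :=
    fun s t hs hst => by
      refine ⟨measureReal_mono (Set.inter_subset_inter_left _ (ball_subset_ball hst)) (hfin t), ?_⟩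
      have h1 : volume.real (ball x t ∩ S) ≤
          volume.real (ball x s ∩ S) + volume.real (ball x t \ ball x s) := by
        refine (measureReal_mono (fun y hy => ?_) ?_).trans (measureReal_union_le _ _)
        · by_cases hys : y ∈ ball x s
          exacts [Or.inl ⟨hys, hy.2⟩, Or.inr ⟨hy.1, hys⟩]
        · refine (measure_union_lt_top (hfin s).lt_top ?_).ne
          exact (measure_mono Set.sdiff_subset).trans_lt measure_ball_lt_top
      rw [measureReal_sdiff (ball_subset_ball hst) measurableSet_ball, hvol t (hs.trans hst),
        hvol s hs] at h1
      linarith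
  have habs : ∀ s ∈ Set.Icc 0 r, ∀ t ∈ Set.Icc 0 r,
      |volume.real (ball x s ∩ S) - volume.real (ball x t ∩ S)| ≤ |s ^ n * ω - t ^ n * ω| :=
    fun s hs t ht => by
      rcases le_total s t with h | h
      · obtain ⟨a, b⟩ := hmono s t hs.1 h
        rw [abs_sub_comm, abs_of_nonneg (sub_nonneg.2 a), abs_sub_comm]
        exact b.trans (le_abs_self _)
      · obtain ⟨a, b⟩ := hmono t s ht.1 h
        rw [abs_of_nonneg (sub_nonneg.2 a)]
        exact b.trans (le_abs_self _)
  have hcont : ContinuousOn (fun s => volume.real (ball x s ∩ S)) (Set.Icc 0 r) := fun s hs => by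
    rw [ContinuousWithinAt, tendsto_iff_dist_tendsto_zero]
    have hc : Tendsto (fun t : ℝ => |t ^ n * ω - s ^ n * ω|) (𝓝[Set.Icc 0 r] s) (𝓝 0) := by
      have : Continuous fun t : ℝ => |t ^ n * ω - s ^ n * ω| := by fun_prop
      simpa using (this.tendsto s).mono_left nhdsWithin_le_nhds
    refine squeeze_zero' (Filter.Eventually.of_forall fun t => dist_nonneg) ?_ hc
    filter_upwards [self_mem_nhdsWithin] with t ht
    exact habs t ht s hs
  have hd' : d ≠ ⊤ := (hd.trans_lt (hfin r).lt_top).ne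
  have hmem : d.toReal ∈ Set.Icc (volume.real (ball x 0 ∩ S)) (volume.real (ball x r ∩ S)) :=
    ⟨by simp, ENNReal.toReal_mono (hfin r) hd⟩
  obtain ⟨s, hs, hsd⟩ := intermediate_value_Icc hr.le hcont hmem
  exact ⟨s, hs, (ENNReal.toReal_eq_toReal_iff' (hfin s) hd').1 hsd⟩

/-- A set of volume at least `m` in a compact set `K` meets one of finitely many balls covering `K`
in a volume bounded below independently of the set. -/
theorem exists_le_volume_ball_inter {n : ℕ} {K : Set (EuclideanSpace ℝ (Fin n))}
    (hK : IsCompact K) {r : ℝ} (hr : 0 < r) {m : ℝ≥0∞} (hm : 0 < m) :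
    ∃ δ : ℝ≥0∞, 0 < δ ∧ ∀ S ⊆ K, m ≤ volume S → ∃ x ∈ K, δ ≤ volume (ball x r ∩ S) := by
  obtain ⟨T, hTK, hKT⟩ := hK.elim_nhds_subcover (fun x => ball x r) fun x _ => ball_mem_nhds x hr
  refine ⟨(min m 1) / (T.card + 1), ENNReal.div_pos (lt_min hm one_pos).ne' (by finiteness),
    fun S hS hSm => ?_⟩
  by_contra! h
  have hle : volume S ≤ ∑ x ∈ T, volume (ball x r ∩ S) := by
    refine (measure_mono fun y hy => ?_).trans (measure_biUnion_finset_le T _)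
    obtain ⟨x, hx, hyx⟩ := Set.mem_iUnion₂.1 (hKT (hS hy))
    exact Set.mem_iUnion₂.2 ⟨x, hx, hyx, hy⟩
  have hmin : min m 1 ≠ 0 := (lt_min hm one_pos).ne'
  have hmin' : min m 1 ≠ ⊤ := (min_le_right m 1).trans_lt ENNReal.one_lt_top |>.ne
  have h2 : ∑ x ∈ T, volume (ball x r ∩ S) ≤ T.card * (min m 1 / (T.card + 1)) := by
    rw [← nsmul_eq_mul]
    exact Finset.sum_le_card_nsmul _ _ _ fun x hx => (h x (hTK x hx)).le
  have h3 : (T.card : ℝ≥0∞) * (min m 1 / (T.card + 1)) < min m 1 := by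
    rw [← mul_div_assoc, ENNReal.div_lt_iff (by simp) (by simp), mul_comm]
    exact ENNReal.mul_lt_mul_right hmin hmin' (ENNReal.lt_add_right (by simp) one_ne_zero)
  exact absurd ((min_le_left m 1).trans (hSm.trans (hle.trans h2))) (not_le.2 h3)

theorem isoProfile_le_add {n : ℕ} {G : Set (EuclideanSpace ℝ (Fin n))} {A B ε : ℝ≥0∞}
    (h : ∀ E : Set (EuclideanSpace ℝ (Fin n)), MeasurableSet E → E ⊆ closure G → volume E = A →
      ∃ E' : Set (EuclideanSpace ℝ (Fin n)), MeasurableSet E' ∧ E' ⊆ closure G ∧ volume E' = B ∧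
        per E' ≤ per E + ε) :
    isoProfile G B ≤ isoProfile G A + ε := by
  rw [isoProfile, isoProfile, ENNReal.sInf_add]
  refine le_iInf₂ fun P hP => ?_
  obtain ⟨E, hE, hEG, hEA, hEP⟩ := hP
  obtain ⟨E', hE', hEG', hEB, hle⟩ := h E hE hEG hEA
  rw [← hEP]
  exact le_trans (sInf_le ⟨E', hE', hEG', hEB, rfl⟩) hle

theorem exists_radius_ofReal_le {n : ℕ} (hn : 2 ≤ n) (C : ℝ) {ε : ℝ≥0∞} (hε : 0 < ε) :
    ∃ r : ℝ, 0 < r ∧ ENNReal.ofReal (C * r ^ (n - 1)) ≤ ε := by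
  have hc : Continuous fun r : ℝ => ENNReal.ofReal (C * r ^ (n - 1)) :=
    ENNReal.continuous_ofReal.comp (by fun_prop)
  have h0 : Tendsto (fun r : ℝ => ENNReal.ofReal (C * r ^ (n - 1))) (𝓝[>] 0) (𝓝 0) := by
    have := hc.tendsto 0
    rw [zero_pow (by omega), mul_zero, ENNReal.ofReal_zero] at this
    exact this.mono_left nhdsWithin_le_nhds
  obtain ⟨r, hr, hr0⟩ := ((h0.eventually (ge_mem_nhds hε)).and self_mem_nhdsWithin).exists
  exact ⟨r, hr0, hr⟩

theorem isoProfile_add_le {n : ℕ} (hn : 2 ≤ n) {G : Set (EuclideanSpace ℝ (Fin n))}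
    (hG : IsOpen G) {A₀ ε : ℝ≥0∞} (hA₀ : A₀ < volume G) (hε : 0 < ε) :
    ∃ δ : ℝ≥0∞, 0 < δ ∧ ∀ A ≤ A₀, ∀ d ≤ δ, isoProfile G (A + d) ≤ isoProfile G A + ε := by
  obtain ⟨K, hKG, hK, hAK⟩ := hG.exists_lt_isCompact hA₀
  obtain ⟨ρ, hρ, hρG⟩ := hK.exists_thickening_subset_open hG hKG
  obtain ⟨C, hC0, hC⟩ := exists_per_ball_le n
  obtain ⟨r₀, hr₀, hr₀ε⟩ := exists_radius_ofReal_le hn C hε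
  obtain ⟨δ, hδ, h⟩ := exists_le_volume_ball_inter hK (lt_min hρ hr₀) (tsub_pos_of_lt hAK)
  refine ⟨δ, hδ, fun A hA d hd => isoProfile_le_add fun E hE hEG hEA => ?_⟩
  obtain ⟨x, hxK, hx⟩ := h (K \ E) Set.sdiff_subset
    ((tsub_le_tsub_left (hEA.trans_le hA) _).trans le_measure_sdiff)
  obtain ⟨s, hs, hsd⟩ := exists_volume_ball_inter_eq (by omega) Eᶜ x (lt_min hρ hr₀)
    (hd.trans (hx.trans (measure_mono (Set.inter_subset_inter_right _ fun y hy => hy.2))))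
  have hvol : volume (E ∪ ball x s) = A + d := by
    rw [← hsd, ← hEA, ← Set.sdiff_eq, ← measure_union disjoint_sdiff_self_right
      (measurableSet_ball.diff hE), Set.union_sdiff_self]
  refine ⟨E ∪ ball x s, hE.union measurableSet_ball, Set.union_subset hEG ?_, hvol, ?_⟩
  · refine Set.Subset.trans (fun y hy => hρG ?_) subset_closure
    exact mem_thickening_iff.2 ⟨x, hxK, (mem_ball.1 hy).trans_le (hs.2.trans (min_le_left _ _))⟩
  · rcases hs.1.eq_or_lt with rfl | hs0
    · simp
    · refine (hC x s hs0 E hE).1.trans ?_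
      gcongr
      refine le_trans ?_ hr₀ε
      gcongr
      exact hs.2.trans (min_le_right _ _)

theorem isoProfile_sub_le {n : ℕ} (hn : 2 ≤ n) {G : Set (EuclideanSpace ℝ (Fin n))}
    (hG : Bornology.IsBounded G) {A₀ ε : ℝ≥0∞} (hA₀ : 0 < A₀) (hε : 0 < ε) :
    ∃ δ : ℝ≥0∞, 0 < δ ∧ ∀ A ≥ A₀, ∀ d ≤ δ, isoProfile G (A - d) ≤ isoProfile G A + ε := by
  obtain ⟨C, hC0, hC⟩ := exists_per_ball_le n
  obtain ⟨r, hr, hrε⟩ := exists_radius_ofReal_le hn C hε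
  obtain ⟨δ, hδ, h⟩ := exists_le_volume_ball_inter hG.isCompact_closure hr hA₀
  refine ⟨δ, hδ, fun A hA d hd => isoProfile_le_add fun E hE hEG hEA => ?_⟩
  obtain ⟨x, hxK, hx⟩ := h E hEG (hA.le.trans_eq hEA.symm)
  obtain ⟨s, hs, hsd⟩ := exists_volume_ball_inter_eq (by omega) E x hr (hd.trans hx)
  have hvol : volume (E \ ball x s) = A - d := by
    rw [← Set.sdiff_inter_self_eq_sdiff, measure_sdiff Set.inter_subset_right
      (measurableSet_ball.inter hE).nullMeasurableSet
      ((measure_mono Set.inter_subset_left).trans_lt measure_ball_lt_top).ne, hsd, hEA]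
  refine ⟨E \ ball x s, hE.diff measurableSet_ball, Set.sdiff_subset.trans hEG, hvol, ?_⟩
  rcases hs.1.eq_or_lt with rfl | hs0
  · simp
  · refine (hC x s hs0 E hE).2.trans ?_
    gcongr
    refine le_trans ?_ hrε
    gcongr
    exact hs.2

theorem isoProfile_zero {n : ℕ} (G : Set (EuclideanSpace ℝ (Fin n))) : isoProfile G 0 = 0 := by
  refine le_antisymm (sInf_le ⟨∅, MeasurableSet.empty, Set.empty_subset _, measure_empty, ?_⟩)
    zero_le
  simp [per, perIn]

theorem continuousWithinAt_of_forall_le_add {X : Type*} [TopologicalSpace X] {f : X → ℝ≥0∞}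
    {s : Set X} {x : X}
    (h : ∀ ε : ℝ≥0∞, 0 < ε → ∀ᶠ y in 𝓝[s] x, f x ≤ f y + ε ∧ f y ≤ f x + ε) :
    ContinuousWithinAt f s x := by
  refine tendsto_order.2 ⟨fun a ha => ?_, fun a ha => ?_⟩
  · obtain ⟨b, hab, hb⟩ := exists_between ha
    filter_upwards [h (b - a) (tsub_pos_of_lt hab)] with y hy
    by_contra! hya
    refine absurd (hy.1.trans (add_le_add_left hya _)) ?_
    rw [add_tsub_cancel_of_le hab.le]
    exact not_le.2 hb
  · obtain ⟨b, hab, hb⟩ := exists_between ha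
    filter_upwards [h (b - f x) (tsub_pos_of_lt hab)] with y hy
    refine hy.2.trans_lt ?_
    rwa [add_tsub_cancel_of_le hab.le]

/-- On a bounded subregion the isoperimetric profile is continuous on `[0, volume G)`. -/
theorem isoProfile_continuous (n : ℕ) (hn : 2 ≤ n)
    (G : Set (EuclideanSpace ℝ (Fin n))) (hGopen : IsOpen G)
    (hGnull : volume (frontier G) = 0) (hGbdd : Bornology.IsBounded G) :
    ContinuousOn (isoProfile G) (Set.Iio (volume G)) := by
  intro A₀ hA₀
  have hA₀top : A₀ ≠ ⊤ := ne_top_of_lt hA₀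
  refine continuousWithinAt_of_forall_le_add fun ε hε => Filter.Eventually.filter_mono
    nhdsWithin_le_nhds ?_
  obtain ⟨δ₁, hδ₁, h₁⟩ := isoProfile_add_le hn hGopen hA₀ hε
  obtain ⟨δ₂, hδ₂, h₂⟩ : ∃ δ : ℝ≥0∞, 0 < δ ∧ ∀ A ≥ A₀, ∀ d ≤ δ, A - d ≤ A₀ →
      isoProfile G (A - d) ≤ isoProfile G A + ε := by
    rcases eq_zero_or_pos A₀ with rfl | hpos
    · refine ⟨1, one_pos, fun A _ d _ hd => ?_⟩
      rw [nonpos_iff_eq_zero.1 hd, isoProfile_zero]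
      exact zero_le
    · obtain ⟨δ, hδ, h⟩ := isoProfile_sub_le hn hGbdd hpos hε
      exact ⟨δ, hδ, fun A hA d hd _ => h A hA d hd⟩
  have hδ : 0 < min δ₁ δ₂ := lt_min hδ₁ hδ₂
  filter_upwards [ENNReal.Icc_mem_nhds hA₀top hδ.ne', gt_mem_nhds hA₀top.lt_top] with y hy hytop
  rcases le_total A₀ y with h | h
  · have hd : y - A₀ ≤ min δ₁ δ₂ := tsub_le_iff_left.2 hy.2
    have e : y - (y - A₀) = A₀ := ENNReal.sub_sub_cancel hytop.ne h
    have h3 := h₂ y h _ (hd.trans (min_le_right _ _)) e.le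
    have h4 := h₁ A₀ le_rfl _ (hd.trans (min_le_left _ _))
    rw [e] at h3
    rw [add_tsub_cancel_of_le h] at h4
    exact ⟨h3, h4⟩
  · have hd : A₀ - y ≤ min δ₁ δ₂ := tsub_le_iff_tsub_le.1 hy.1
    have e : A₀ - (A₀ - y) = y := ENNReal.sub_sub_cancel hA₀top h
    have h3 := h₂ A₀ le_rfl _ (hd.trans (min_le_right _ _)) (e.trans_le h)
    have h4 := h₁ y h _ (hd.trans (min_le_left _ _))
    rw [e] at h3
    rw [add_tsub_cancel_of_le h] at h4
    exact ⟨h4, h3⟩
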